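/- arXiv:1303.2389 — 3 statements merged into one kernel-verified Lean document; each statement's English description precedes it below -/
import Mathlib

section
/- Fix an integer B ≥ 1 and let f(x) = x^{B/2−1} e^{−x/2} / (2^{B/2} Γ(B/2)). For τ > 0 define D(τ) = [−(B + τ²) ∫_{τ²}^∞ (τ − √x) f(x) dx + τ ∫_{τ²}^∞ (√x − τ)² f(x) dx] / [Bτ − B ∫_{τ²}^∞ (τ − √x) f(x) dx]. Then lim_{τ→∞} log(1/D(τ)) / (τ²/2) = 1. -/
open MeasureTheory Real Set Filter

/-- The chi-square density with `B` degrees of freedom. -/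
noncomputable def chiSqDensity (B : ℕ) (x : ℝ) : ℝ :=
  x ^ ((B : ℝ) / 2 - 1) * Real.exp (-x / 2) /
    ((2 : ℝ) ^ ((B : ℝ) / 2) * Real.Gamma ((B : ℝ) / 2))

/-- The undersampling ratio `δ` of the group LASSO phase transition, parametrized by
the optimal block soft threshold `τ`. -/
noncomputable def groupLassoDelta (B : ℕ) (τ : ℝ) : ℝ :=
  (-(B + τ ^ 2) * (∫ x in Ioi (τ ^ 2), (τ - Real.sqrt x) * chiSqDensity B x) +
      τ * ∫ x in Ioi (τ ^ 2), (Real.sqrt x - τ) ^ 2 * chiSqDensity B x) /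
    (B * τ - B * ∫ x in Ioi (τ ^ 2), (τ - Real.sqrt x) * chiSqDensity B x)

theorem aux_quad (a b c : ℝ) :
    Tendsto (fun τ : ℝ => (a + b * τ + c * τ ^ 2) / (τ ^ 2 / 2)) atTop (nhds (2 * c)) := by
  have h : Tendsto (fun τ : ℝ => 2 * a * (τ⁻¹) ^ 2 + 2 * b * τ⁻¹ + 2 * c) atTop
      (nhds (2 * a * 0 ^ 2 + 2 * b * 0 + 2 * c)) :=
    (((tendsto_inv_atTop_zero.pow 2).const_mul _).add
      (tendsto_inv_atTop_zero.const_mul _)).add tendsto_const_nhds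
  have e : 2 * a * 0 ^ 2 + 2 * b * 0 + 2 * c = 2 * c := by ring
  rw [e] at h
  refine h.congr' ?_
  filter_upwards [eventually_gt_atTop 0] with τ hτ
  field_simp

theorem aux_Z (B : ℕ) (hB : 1 ≤ B) :
    0 < (2 : ℝ) ^ ((B : ℝ) / 2) * Real.Gamma ((B : ℝ) / 2) := by
  have : (0 : ℝ) < B := by exact_mod_cast hB
  have := Real.Gamma_pos_of_pos (s := (B : ℝ) / 2) (by positivity)
  positivity

theorem aux_nonneg (B : ℕ) (hB : 1 ≤ B) (x : ℝ) (hx : 0 ≤ x) : 0 ≤ chiSqDensity B x := by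
  have := aux_Z B hB
  unfold chiSqDensity
  positivity

theorem aux_meas (B : ℕ) : Measurable (chiSqDensity B) := by
  unfold chiSqDensity
  fun_prop

theorem aux_int (B : ℕ) (ε : ℝ) (hε : 0 < ε) :
    IntegrableOn (fun x : ℝ => x ^ ((B : ℝ) / 2) * Real.exp (-(ε / 2) * x)) (Ioi 0) := by
  have h := integrableOn_rpow_mul_exp_neg_mul_rpow (s := (B : ℝ) / 2) (p := 1) (b := ε / 2)
    (by have : (0 : ℝ) ≤ B := by positivity
        linarith) one_pos (by positivity)
  simpa using h

/-- domination -/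
theorem aux_dom (B : ℕ) (hB : 1 ≤ B) (ε : ℝ) (hε1 : ε ≤ 1) (τ x : ℝ)
    (hτ : 1 ≤ τ) (hx : τ ^ 2 < x) :
    x * chiSqDensity B x ≤
      Real.exp (-(1 - ε) * τ ^ 2 / 2) / ((2 : ℝ) ^ ((B : ℝ) / 2) * Real.Gamma ((B : ℝ) / 2)) *
        (x ^ ((B : ℝ) / 2) * Real.exp (-(ε / 2) * x)) := by
  have hZ := aux_Z B hB
  have hx0 : 0 < x := by nlinarith
  unfold chiSqDensity
  set Z := (2 : ℝ) ^ ((B : ℝ) / 2) * Real.Gamma ((B : ℝ) / 2)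
  have h1 : x * x ^ ((B : ℝ) / 2 - 1) = x ^ ((B : ℝ) / 2) := by
    rw [Real.rpow_sub_one hx0.ne']; field_simp
  have h2 : Real.exp (-x / 2) ≤ Real.exp (-(1 - ε) * τ ^ 2 / 2) * Real.exp (-(ε / 2) * x) := by
    rw [← Real.exp_add]
    apply Real.exp_le_exp.2
    nlinarith [mul_nonneg (sub_nonneg.2 hε1) (sub_nonneg.2 hx.le)]
  calc x * (x ^ ((B : ℝ) / 2 - 1) * Real.exp (-x / 2) / Z)
      = (x * x ^ ((B : ℝ) / 2 - 1)) * Real.exp (-x / 2) / Z := by ring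
    _ = x ^ ((B : ℝ) / 2) * Real.exp (-x / 2) / Z := by rw [h1]
    _ ≤ x ^ ((B : ℝ) / 2) * (Real.exp (-(1 - ε) * τ ^ 2 / 2) * Real.exp (-(ε / 2) * x)) / Z := by
        gcongr
    _ = _ := by ring

theorem aux_sqrt (τ x : ℝ) (hτ : 1 ≤ τ) (hx : τ ^ 2 < x) :
    0 ≤ √x - τ ∧ √x - τ ≤ x ∧ (√x - τ) ^ 2 ≤ x := by
  have hx0 : 0 < x := by nlinarith
  have h1 : τ ≤ √x := Real.le_sqrt_of_sq_le hx.le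
  have h2 := Real.sq_sqrt hx0.le
  refine ⟨by linarith, by nlinarith, by nlinarith⟩

theorem aux_upper (B : ℕ) (hB : 1 ≤ B) (ε : ℝ) (hε : 0 < ε) (hε1 : ε ≤ 1) :
    ∃ K : ℝ, 0 < K ∧ ∀ τ : ℝ, 1 ≤ τ → ∀ g : ℝ → ℝ,
      (∀ x, τ ^ 2 < x → 0 ≤ g x ∧ g x ≤ x) → Measurable g →
      IntegrableOn (fun x => g x * chiSqDensity B x) (Ioi (τ ^ 2)) ∧
      0 ≤ ∫ x in Ioi (τ ^ 2), g x * chiSqDensity B x ∧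
      ∫ x in Ioi (τ ^ 2), g x * chiSqDensity B x ≤ K * Real.exp (-(1 - ε) * τ ^ 2 / 2) := by
  have hZ := aux_Z B hB
  have hI := aux_int B ε hε
  set Z := (2 : ℝ) ^ ((B : ℝ) / 2) * Real.Gamma ((B : ℝ) / 2) with hZdef
  set J := ∫ x in Ioi (0 : ℝ), x ^ ((B : ℝ) / 2) * Real.exp (-(ε / 2) * x) with hJ
  have hJ0 : 0 ≤ J := by
    apply setIntegral_nonneg measurableSet_Ioi
    intro x hx
    have : (0 : ℝ) < x := hx
    positivity
  refine ⟨J / Z + 1, by positivity, ?_⟩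
  intro τ hτ g hg hgm
  have hsub : Ioi (τ ^ 2) ⊆ Ioi (0 : ℝ) := Ioi_subset_Ioi (by positivity)
  have hI2 := hI.mono_set hsub
  have hI3 := hI2.const_mul (Real.exp (-(1 - ε) * τ ^ 2 / 2) / Z)
  have hnn : ∀ x, τ ^ 2 < x → 0 ≤ g x * chiSqDensity B x := fun x hx =>
    mul_nonneg (hg x hx).1 (aux_nonneg B hB x (by nlinarith))
  have hle : ∀ x, τ ^ 2 < x → g x * chiSqDensity B x ≤
      Real.exp (-(1 - ε) * τ ^ 2 / 2) / Z * (x ^ ((B : ℝ) / 2) * Real.exp (-(ε / 2) * x)) :=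
    fun x hx => (mul_le_mul_of_nonneg_right (hg x hx).2
      (aux_nonneg B hB x (by nlinarith))).trans (aux_dom B hB ε hε1 τ x hτ hx)
  have hint : IntegrableOn (fun x => g x * chiSqDensity B x) (Ioi (τ ^ 2)) := by
    refine Integrable.mono' hI3 (hgm.mul (aux_meas B)).aestronglyMeasurable ?_
    refine (ae_restrict_iff' measurableSet_Ioi).2 (Eventually.of_forall fun x hx => ?_)
    rw [Real.norm_of_nonneg (hnn x hx)]
    exact hle x hx
  refine ⟨hint, setIntegral_nonneg measurableSet_Ioi hnn, ?_⟩
  calc ∫ x in Ioi (τ ^ 2), g x * chiSqDensity B x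
      ≤ ∫ x in Ioi (τ ^ 2), Real.exp (-(1 - ε) * τ ^ 2 / 2) / Z *
          (x ^ ((B : ℝ) / 2) * Real.exp (-(ε / 2) * x)) :=
        setIntegral_mono_on hint hI3 measurableSet_Ioi hle
    _ = Real.exp (-(1 - ε) * τ ^ 2 / 2) / Z * ∫ x in Ioi (τ ^ 2),
          (x ^ ((B : ℝ) / 2) * Real.exp (-(ε / 2) * x)) := integral_const_mul _ _
    _ ≤ Real.exp (-(1 - ε) * τ ^ 2 / 2) / Z * J := by
        gcongr
        refine setIntegral_mono_set hI ?_ (Eventually.of_forall hsub)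
        refine (ae_restrict_iff' measurableSet_Ioi).2 (Eventually.of_forall fun x hx => ?_)
        have : (0 : ℝ) < x := hx
        simp only [Pi.zero_apply]
        positivity
    _ ≤ (J / Z + 1) * Real.exp (-(1 - ε) * τ ^ 2 / 2) := by
        have := Real.exp_pos (-(1 - ε) * τ ^ 2 / 2)
        rw [add_mul, div_mul_eq_mul_div, div_mul_eq_mul_div, mul_comm]
        linarith

theorem aux_flow (B : ℕ) (hB : 1 ≤ B) (τ x : ℝ) (hτ : 1 ≤ τ) (h1 : 1 ≤ x)
    (h2 : x ≤ (τ + 2) ^ 2) :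
    Real.exp (-(τ + 2) ^ 2 / 2 - 2 * (τ + 2)) /
      ((2 : ℝ) ^ ((B : ℝ) / 2) * Real.Gamma ((B : ℝ) / 2)) ≤ chiSqDensity B x := by
  have hZ := aux_Z B hB
  unfold chiSqDensity
  gcongr
  have hx0 : 0 < x := by linarith
  have a1 : x ^ (-1 : ℝ) ≤ x ^ ((B : ℝ) / 2 - 1) := by
    apply Real.rpow_le_rpow_of_exponent_le h1
    have : (0 : ℝ) ≤ B := by positivity
    linarith
  have a2 : Real.exp (-(2 * (τ + 2))) ≤ x ^ (-1 : ℝ) := by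
    rw [Real.rpow_neg_one, Real.exp_neg]
    apply inv_anti₀ hx0
    have : τ + 2 ≤ Real.exp (τ + 2) := by linarith [Real.add_one_le_exp (τ + 2)]
    calc x ≤ (τ + 2) ^ 2 := h2
      _ ≤ (Real.exp (τ + 2)) ^ 2 := by gcongr
      _ = _ := by rw [← Real.exp_nat_mul]; norm_num
  calc Real.exp (-(τ + 2) ^ 2 / 2 - 2 * (τ + 2))
      = Real.exp (-(2 * (τ + 2))) * Real.exp (-(τ + 2) ^ 2 / 2) := by
        rw [← Real.exp_add]; ring_nf
    _ ≤ _ := by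
        apply mul_le_mul (a2.trans a1) _ (Real.exp_pos _).le (by positivity)
        apply Real.exp_le_exp.2
        linarith

theorem aux_lower (B : ℕ) (hB : 1 ≤ B) (τ : ℝ) (hτ : 1 ≤ τ)
    (hint : IntegrableOn (fun x => (√x - τ) * chiSqDensity B x) (Ioi (τ ^ 2))) :
    Real.exp (-(τ + 2) ^ 2 / 2 - 2 * (τ + 2)) /
      ((2 : ℝ) ^ ((B : ℝ) / 2) * Real.Gamma ((B : ℝ) / 2)) ≤
      ∫ x in Ioi (τ ^ 2), (√x - τ) * chiSqDensity B x := by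
  have hZ := aux_Z B hB
  have hfl := aux_flow B hB τ
  set c := Real.exp (-(τ + 2) ^ 2 / 2 - 2 * (τ + 2)) /
      ((2 : ℝ) ^ ((B : ℝ) / 2) * Real.Gamma ((B : ℝ) / 2)) with hc
  have hc0 : 0 < c := by positivity
  have hsub : Ioc ((τ + 1) ^ 2) ((τ + 2) ^ 2) ⊆ Ioi (τ ^ 2) := by
    intro x hx
    have := hx.1
    show τ ^ 2 < x
    nlinarith
  calc c ≤ ∫ x in Ioc ((τ + 1) ^ 2) ((τ + 2) ^ 2), c := by
        rw [setIntegral_const, Real.volume_real_Ioc_of_le (by nlinarith), smul_eq_mul]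
        nlinarith
    _ ≤ ∫ x in Ioc ((τ + 1) ^ 2) ((τ + 2) ^ 2), (√x - τ) * chiSqDensity B x := by
        refine setIntegral_mono_on (by simp) (hint.mono_set hsub)
          measurableSet_Ioc ?_
        intro x hx
        have h1 : τ + 1 ≤ √x := Real.le_sqrt_of_sq_le hx.1.le
        have h2 := hfl x hτ (by nlinarith [hx.1]) hx.2
        nlinarith
    _ ≤ _ := by
        refine setIntegral_mono_set hint ?_ (Eventually.of_forall hsub)
        refine (ae_restrict_iff' measurableSet_Ioi).2 (Eventually.of_forall fun x hx => ?_)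
        exact mul_nonneg (aux_sqrt τ x hτ hx).1
          (aux_nonneg B hB x ((sq_nonneg τ).trans (le_of_lt hx)))

theorem aux_rw (B : ℕ) (τ : ℝ) : groupLassoDelta B τ =
    ((B + τ ^ 2) * (∫ x in Ioi (τ ^ 2), (√x - τ) * chiSqDensity B x) +
      τ * ∫ x in Ioi (τ ^ 2), (√x - τ) ^ 2 * chiSqDensity B x) /
    (B * τ + B * ∫ x in Ioi (τ ^ 2), (√x - τ) * chiSqDensity B x) := by
  have : (∫ x in Ioi (τ ^ 2), (τ - √x) * chiSqDensity B x) =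
      - ∫ x in Ioi (τ ^ 2), (√x - τ) * chiSqDensity B x := by
    rw [← integral_neg]
    congr 1
    ext x
    ring
  unfold groupLassoDelta
  rw [this]
  congr 1 <;> ring

theorem aux_both (B : ℕ) (hB : 1 ≤ B) (ε : ℝ) (hε : 0 < ε) (hε1 : ε ≤ 1) :
    ∃ K L : ℝ, 0 < K ∧ 0 < L ∧ ∀ᶠ τ : ℝ in atTop,
      groupLassoDelta B τ ≤ K * Real.exp (τ - (1 - ε) * τ ^ 2 / 2) ∧
      L * Real.exp (-(τ + 2) ^ 2 / 2 - 2 * (τ + 2)) ≤ groupLassoDelta B τ := by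
  obtain ⟨K, hK, h⟩ := aux_upper B hB ε hε hε1
  have hZ := aux_Z B hB
  have hB1 : (1 : ℝ) ≤ B := by exact_mod_cast hB
  refine ⟨3 * K, (2 * (B : ℝ))⁻¹ *
    ((2 : ℝ) ^ ((B : ℝ) / 2) * Real.Gamma ((B : ℝ) / 2))⁻¹, by positivity, by positivity, ?_⟩
  filter_upwards [eventually_ge_atTop 1, eventually_ge_atTop K] with τ hτ hτK
  obtain ⟨hPi, hP0, hPu⟩ := h τ hτ (fun x => √x - τ)
    (fun x hx => ⟨(aux_sqrt τ x hτ hx).1, (aux_sqrt τ x hτ hx).2.1⟩) (by fun_prop)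
  obtain ⟨-, hQ0, hQu⟩ := h τ hτ (fun x => (√x - τ) ^ 2)
    (fun x hx => ⟨sq_nonneg _, (aux_sqrt τ x hτ hx).2.2⟩) (by fun_prop)
  have hPl := aux_lower B hB τ hτ hPi
  rw [aux_rw]
  set P := ∫ x in Ioi (τ ^ 2), (√x - τ) * chiSqDensity B x
  set Q := ∫ x in Ioi (τ ^ 2), (√x - τ) ^ 2 * chiSqDensity B x
  set Z := (2 : ℝ) ^ ((B : ℝ) / 2) * Real.Gamma ((B : ℝ) / 2)
  set E := Real.exp (-(1 - ε) * τ ^ 2 / 2) with hE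
  have hE0 : 0 < E := Real.exp_pos _
  have hE1 : E ≤ 1 := by
    apply Real.exp_le_one_iff.2
    nlinarith [mul_nonneg (sub_nonneg.2 hε1) (sq_nonneg τ)]
  have hBτ : 0 < B * τ := by positivity
  have hden : 0 < B * τ + B * P := by positivity
  constructor
  · have e1 : Real.exp (τ - (1 - ε) * τ ^ 2 / 2) = Real.exp τ * E := by
      rw [hE, ← Real.exp_add]; ring_nf
    have e2 : τ ≤ Real.exp τ := by linarith [Real.add_one_le_exp τ]
    rw [e1, div_le_iff₀ hden]
    have s1 : (B + τ ^ 2) * P ≤ (2 * (B * τ) * τ) * (K * E) := by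
      apply mul_le_mul _ hPu hP0 (by positivity)
      nlinarith [mul_nonneg (sub_nonneg.2 hB1) (sq_nonneg τ), mul_self_nonneg (τ - 1),
        mul_le_mul_of_nonneg_left (one_le_pow₀ hτ : 1 ≤ τ ^ 2) (by linarith : (0 : ℝ) ≤ B)]
    have s2 : τ * Q ≤ ((B * τ) * τ) * (K * E) := by
      apply mul_le_mul _ hQu hQ0 (by positivity)
      nlinarith [mul_le_mul hB1 hτ zero_le_one (by linarith)]
    have s3 : 3 * K * (τ * E) * (B * τ) ≤ 3 * K * (Real.exp τ * E) * (B * τ + B * P) := by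
      gcongr
      nlinarith
    linarith
  · rw [le_div_iff₀ hden]
    have hPK : P ≤ τ := hPu.trans (by nlinarith)
    have hZc : Z⁻¹ * Real.exp (-(τ + 2) ^ 2 / 2 - 2 * (τ + 2)) ≤ P := by
      rw [mul_comm, ← div_eq_mul_inv]; exact hPl
    have hBP : B * τ + B * P ≤ 2 * B * τ := by nlinarith
    calc (2 * (B : ℝ))⁻¹ * Z⁻¹ * Real.exp (-(τ + 2) ^ 2 / 2 - 2 * (τ + 2)) * (B * τ + B * P)
        = (2 * (B : ℝ))⁻¹ * (Z⁻¹ * Real.exp (-(τ + 2) ^ 2 / 2 - 2 * (τ + 2))) *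
          (B * τ + B * P) := by ring
      _ ≤ (2 * (B : ℝ))⁻¹ * P * (2 * B * τ) := by gcongr
      _ = P * τ := by field_simp
      _ ≤ P * (B + τ ^ 2) := by
          gcongr
          nlinarith
      _ ≤ _ := by nlinarith

/-- `log(1/D(τ)) ∼ τ²/2` as `τ → ∞`. -/
theorem stmt9 (B : ℕ) (hB : 1 ≤ B) :
    Tendsto (fun τ : ℝ => Real.log (1 / groupLassoDelta B τ) / (τ ^ 2 / 2))
      atTop (nhds 1) := by
  have key : ∀ ε : ℝ, 0 < ε → ε ≤ 1 → ∃ a b : ℝ, ∀ᶠ τ : ℝ in atTop,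
      (a + (-1) * τ + ((1 - ε) / 2) * τ ^ 2) / (τ ^ 2 / 2) ≤
        Real.log (1 / groupLassoDelta B τ) / (τ ^ 2 / 2) ∧
      Real.log (1 / groupLassoDelta B τ) / (τ ^ 2 / 2) ≤
        (b + 4 * τ + (1 / 2) * τ ^ 2) / (τ ^ 2 / 2) := by
    intro ε hε hε1
    obtain ⟨K, L, hK, hL, h⟩ := aux_both B hB ε hε hε1
    refine ⟨-Real.log K, -Real.log L + 6, ?_⟩
    filter_upwards [h] with τ ⟨h1, h2⟩
    have hD : 0 < groupLassoDelta B τ := lt_of_lt_of_le (by positivity) h2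
    have l1 := Real.log_le_log hD h1
    have l2 := Real.log_le_log (by positivity) h2
    rw [Real.log_mul (by positivity) (by positivity), Real.log_exp] at l1 l2
    rw [one_div, Real.log_inv]
    constructor
    · gcongr
      linarith
    · gcongr
      linarith
  rw [tendsto_order]
  constructor
  · intro a ha
    obtain ⟨p, q, h⟩ := key (min ((1 - a) / 2) 1) (lt_min (by linarith) one_pos) (min_le_right _ _)
    have hm := min_le_left ((1 - a) / 2) 1
    have ht := (aux_quad p (-1) ((1 - min ((1 - a) / 2) 1) / 2)).eventually_const_lt
      (u := a) (by linarith)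
    filter_upwards [h, ht] with τ h1 h2
    exact h2.trans_le h1.1
  · intro a ha
    obtain ⟨p, q, h⟩ := key 1 one_pos le_rfl
    have ht := (aux_quad q 4 (1 / 2)).eventually_lt_const (u := a) (by linarith)
    filter_upwards [h, ht] with τ h1 h2
    exact h1.2.trans_lt h2
end

section
/- Fix an integer B ≥ 1 and let f(x) = x^{B/2−1} e^{−x/2} / (2^{B/2} Γ(B/2)). For τ > 0 define D(τ) = [−(B + τ²) ∫_{τ²}^∞ (τ − √x) f(x) dx + τ ∫_{τ²}^∞ (√x − τ)² f(x) dx] / [Bτ − B ∫_{τ²}^∞ (τ − √x) f(x) dx] and R(τ) = [B·D(τ) − ∫_{τ²}^∞ (√x − τ)² f(x) dx] / [D(τ)(B + τ² − ∫_{τ²}^∞ (√x − τ)² f(x) dx)]. Then lim_{τ→∞} R(τ) · 2 log(1/D(τ)) / B = 1. (This is the precise form of the statement that the group LASSO phase transition satisfies ρ^L(δ) ∼ B / (2 log(1/δ)) as δ → 0.) -/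
open MeasureTheory Real Set Filter

/-- The normalized sparsity `ρ` of the group LASSO phase transition, parametrized by
the optimal block soft threshold `τ`. -/
noncomputable def groupLassoRho (B : ℕ) (τ : ℝ) : ℝ :=
  (B * groupLassoDelta B τ - ∫ x in Ioi (τ ^ 2), (Real.sqrt x - τ) ^ 2 * chiSqDensity B x) /
    (groupLassoDelta B τ *
      (B + τ ^ 2 - ∫ x in Ioi (τ ^ 2), (Real.sqrt x - τ) ^ 2 * chiSqDensity B x))


/-- `x ^ s * exp (-x/2)`. -/
noncomputable def auxE (s x : ℝ) : ℝ := x ^ s * Real.exp (-x / 2)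

lemma auxE_tendsto (s : ℝ) : Tendsto (auxE s) atTop (nhds 0) := by
  have h := tendsto_rpow_mul_exp_neg_mul_atTop_nhds_zero s (1/2) (by norm_num)
  refine h.congr fun x => ?_
  unfold auxE
  congr 2
  ring

lemma auxE_integrable (s a : ℝ) (ha : 0 < a) : IntegrableOn (auxE s) (Ioi a) := by
  refine integrable_of_isBigO_exp_neg (b := 1/4) (by norm_num) ?_ ?_
  · intro x hx
    have hx0 : x ≠ 0 := (lt_of_lt_of_le ha hx).ne'
    apply ContinuousAt.continuousWithinAt
    unfold auxE
    exact (Real.continuousAt_rpow_const x s (Or.inl hx0)).mul (by fun_prop)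
  · have h := (isLittleO_rpow_exp_pos_mul_atTop s (b := 1/4) (by norm_num)).isBigO
    have h2 := h.mul (Asymptotics.isBigO_refl (fun x : ℝ => Real.exp (-x/2)) atTop)
    refine h2.congr (fun x => rfl) fun x => ?_
    rw [← Real.exp_add]
    congr 1
    ring

lemma auxE_deriv (s x : ℝ) (hx : 0 < x) :
    HasDerivAt (auxE s) (s * auxE (s - 1) x - auxE s x / 2) x := by
  have h1 := Real.hasDerivAt_rpow_const (x := x) (p := s) (Or.inl hx.ne')
  have h2 : HasDerivAt (fun x : ℝ => Real.exp (-x / 2)) (Real.exp (-x/2) * (-1/2)) x :=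
    (((hasDerivAt_id x).neg).div_const 2).exp
  have := h1.mul h2
  refine HasDerivAt.congr_deriv (f := auxE s) this ?_
  unfold auxE
  ring

lemma auxE_integral (s a : ℝ) (ha : 0 < a) :
    ∫ x in Ioi a, (s * auxE (s - 1) x - auxE s x / 2) = - auxE s a := by
  have := integral_Ioi_of_hasDerivAt_of_tendsto' (a := a) (f := auxE s)
    (f' := fun x => s * auxE (s - 1) x - auxE s x / 2) (m := 0)
    (fun x hx => auxE_deriv s x (lt_of_lt_of_le ha hx))
    (((auxE_integrable _ a ha).const_mul s).sub ((auxE_integrable s a ha).div_const 2))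
    (auxE_tendsto s)
  rw [this, zero_sub]

lemma auxE_half (s x : ℝ) (hx : 0 < x) : auxE (s + 1/2) x = √x * auxE s x := by
  unfold auxE
  rw [Real.rpow_add hx, Real.sqrt_eq_rpow]; ring

lemma auxE_pos (s x : ℝ) (hx : 0 < x) : 0 < auxE s x := by
  unfold auxE; positivity

/-- First moment integral (unnormalised). -/
noncomputable def auxJ1 (b τ : ℝ) : ℝ := ∫ x in Ioi (τ ^ 2), (√x - τ) * auxE (b - 1) x
/-- Second moment integral (unnormalised). -/
noncomputable def auxJ2 (b τ : ℝ) : ℝ := ∫ x in Ioi (τ ^ 2), (√x - τ) ^ 2 * auxE (b - 1) x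

lemma auxJ1_int (b τ : ℝ) (hτ : 0 < τ) :
    IntegrableOn (fun x => (√x - τ) * auxE (b - 1) x) (Ioi (τ ^ 2)) := by
  have ha : 0 < τ ^ 2 := by positivity
  refine ((auxE_integrable (b - 1 + 1/2) _ ha).sub
    ((auxE_integrable (b - 1) _ ha).const_mul τ)).congr_fun ?_ measurableSet_Ioi
  intro x hx
  have hx0 : 0 < x := ha.trans hx
  simp only [Pi.sub_apply]
  rw [auxE_half _ _ hx0]; ring

lemma auxJ2_int (b τ : ℝ) (hτ : 0 < τ) :
    IntegrableOn (fun x => (√x - τ) ^ 2 * auxE (b - 1) x) (Ioi (τ ^ 2)) := by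
  have ha : 0 < τ ^ 2 := by positivity
  refine (((auxE_integrable (b - 1 + 1/2 + 1/2) _ ha).sub
    ((auxE_integrable (b - 1 + 1/2) _ ha).const_mul (2 * τ))).add
    ((auxE_integrable (b - 1) _ ha).const_mul (τ ^ 2))).congr_fun ?_ measurableSet_Ioi
  intro x hx
  have hx0 : 0 < x := ha.trans hx
  simp only [Pi.sub_apply, Pi.add_apply]
  rw [auxE_half _ _ hx0, auxE_half _ _ hx0]; ring

lemma auxJ2_nonneg (b τ : ℝ) : 0 ≤ auxJ2 b τ := by
  refine setIntegral_nonneg measurableSet_Ioi fun x hx => ?_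
  have hx0 : 0 < x := lt_of_le_of_lt (sq_nonneg τ) hx
  have := auxE_pos (b-1) x hx0
  positivity

lemma auxJ2_le (b τ : ℝ) (hb : 1/2 ≤ b) (hτ : 2 * b + 2 ≤ τ) : auxJ2 b τ ≤ auxJ1 b τ := by
  have hτ0 : 0 < τ := by linarith
  have ha : 0 < τ ^ 2 := by positivity
  have hI : ∀ s, IntegrableOn (fun x => s * auxE (s - 1) x - auxE s x / 2) (Ioi (τ^2)) := fun s =>
    ((auxE_integrable _ _ ha).const_mul s).sub ((auxE_integrable s _ ha).div_const 2)
  set G : ℝ → ℝ → ℝ := fun s x => s * auxE (s - 1) x - auxE s x / 2 with hG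
  have h0 : ∫ x in Ioi (τ^2), (G (b + 1/2) x - 2 * τ * G b x + τ ^ 2 * G (b - 1/2) x) = 0 := by
    have hI' : ∀ s, Integrable (G s) (volume.restrict (Ioi (τ^2))) := hI
    have i1 : Integrable (fun x => G (b + 1/2) x - 2 * τ * G b x)
        (volume.restrict (Ioi (τ^2))) := (hI' _).sub ((hI' _).const_mul _)
    rw [integral_add i1 ((hI' _).const_mul _),
      integral_sub (hI' _) ((hI' _).const_mul _), integral_const_mul, integral_const_mul]
    simp only [hG]
    rw [auxE_integral _ _ ha, auxE_integral _ _ ha, auxE_integral _ _ ha]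
    have e1 := auxE_half b _ ha
    have e2 := auxE_half (b - 1/2) _ ha
    rw [show b - 1/2 + 1/2 = b by ring] at e2
    rw [Real.sqrt_sq hτ0.le] at e1 e2
    rw [e1, e2]; ring
  have hle : ∫ x in Ioi (τ^2), (G (b + 1/2) x - 2 * τ * G b x + τ ^ 2 * G (b - 1/2) x) ≤
      ∫ x in Ioi (τ^2), ((√x - τ) * auxE (b - 1) x - (√x - τ) ^ 2 * auxE (b - 1) x) := by
    refine setIntegral_mono_on (((hI _).sub ((hI _).const_mul _)).add ((hI _).const_mul _))
      ((auxJ1_int b τ hτ0).sub (auxJ2_int b τ hτ0)) measurableSet_Ioi fun x hx => ?_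
    have hx0 : 0 < x := ha.trans hx
    have hu : τ < √x := Real.lt_sqrt_of_sq_lt hx
    have hu0 : 0 < √x := hτ0.trans hu
    have e1 := auxE_half (b - 1) x hx0
    have e2 := auxE_half (b - 1 + 1/2) x hx0
    have e3 := auxE_half (b - 1 + 1/2 + 1/2) x hx0
    have e4 := auxE_half (b - 3/2) x hx0
    have hw := auxE_pos (b - 3/2) x hx0
    rw [show b - 3/2 + 1/2 = b - 1 by ring] at e4
    simp only [hG]
    rw [show b + 1/2 - 1 = b - 1 + 1/2 by ring, show b + 1/2 = b - 1 + 1/2 + 1/2 + 1/2 by ring,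
      show b - 1/2 - 1 = b - 3/2 by ring, show b - 1/2 = b - 1 + 1/2 by ring]
    have e5 : auxE b x = √x * auxE (b - 1 + 1/2) x := by
      rw [← e2]; congr 1; ring
    rw [e5, e3, e2, e1, e4]
    set u := √x
    set v := auxE (b - 3/2) x
    have key : 0 ≤ v * ((u - τ) ^ 2 * (u ^ 2 / 2 - (b - 1/2) - u)) := by
      have : 0 ≤ u ^ 2 / 2 - (b - 1/2) - u := by nlinarith
      positivity
    nlinarith [key]
  rw [h0, integral_sub (auxJ1_int b τ hτ0) (auxJ2_int b τ hτ0)] at hle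
  unfold auxJ1 auxJ2
  linarith

lemma auxJ1_upper (b τ : ℝ) (hb : 1/2 ≤ b) (hτ : 4 * b + 1 ≤ τ) :
    auxJ1 b τ ≤ 4 * auxE (b - 1/2) (τ ^ 2) := by
  have hτ0 : 0 < τ := by linarith
  have ha : 0 < τ ^ 2 := by positivity
  have h := auxE_integral (b - 1/2) _ ha
  have h2 : auxJ1 b τ ≤ ∫ x in Ioi (τ^2),
      (-4) * ((b - 1/2) * auxE (b - 1/2 - 1) x - auxE (b - 1/2) x / 2) := by
    refine setIntegral_mono_on (auxJ1_int b τ hτ0)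
      ((((auxE_integrable _ _ ha).const_mul _).sub
        ((auxE_integrable _ _ ha).div_const 2)).const_mul _) measurableSet_Ioi fun x hx => ?_
    have hx0 : 0 < x := ha.trans hx
    have hu : τ < √x := Real.lt_sqrt_of_sq_lt hx
    have e1 := auxE_half (b - 1) x hx0
    have e4 := auxE_half (b - 3/2) x hx0
    have hw := auxE_pos (b - 3/2) x hx0
    rw [show b - 3/2 + 1/2 = b - 1 by ring] at e4
    rw [show b - 1 + 1/2 = b - 1/2 by ring] at e1
    rw [show b - 1/2 - 1 = b - 3/2 by ring, e1, e4]
    set u := √x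
    set v := auxE (b - 3/2) x
    have : 0 ≤ v * (u ^ 2 + τ * u - 4 * (b - 1/2)) := by
      have : 0 ≤ u ^ 2 + τ * u - 4 * (b - 1/2) := by nlinarith
      positivity
    nlinarith
  rw [integral_const_mul, h] at h2
  linarith

lemma auxJ1_lower (b τ : ℝ) (hb : 1/2 ≤ b) (hτ : 1 ≤ τ) :
    (τ + 2)⁻¹ * Real.exp (-(τ + 2) ^ 2 / 2) ≤ auxJ1 b τ := by
  have hτ0 : 0 < τ := by linarith
  have hsub : Ioc ((τ + 1) ^ 2) ((τ + 1) ^ 2 + 1) ⊆ Ioi (τ ^ 2) := by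
    intro x hx
    have := hx.1
    simp only [mem_Ioi]; nlinarith
  have h1 : ∫ x in Ioc ((τ + 1) ^ 2) ((τ + 1) ^ 2 + 1), (√x - τ) * auxE (b - 1) x ≤ auxJ1 b τ := by
    refine setIntegral_mono_set (auxJ1_int b τ hτ0) ?_ hsub.eventuallyLE
    filter_upwards [ae_restrict_mem measurableSet_Ioi] with x hx
    have hx0 : 0 < x := lt_of_le_of_lt (sq_nonneg τ) hx
    have hu : τ < √x := Real.lt_sqrt_of_sq_lt hx
    have := auxE_pos (b-1) x hx0
    have h3 : 0 < √x - τ := by linarith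
    simp only [Pi.zero_apply]
    positivity
  refine le_trans ?_ h1
  have h2 : ∫ x in Ioc ((τ + 1) ^ 2) ((τ + 1) ^ 2 + 1),
      (τ + 2)⁻¹ * Real.exp (-(τ + 2) ^ 2 / 2) ≤
      ∫ x in Ioc ((τ + 1) ^ 2) ((τ + 1) ^ 2 + 1), (√x - τ) * auxE (b - 1) x := by
    refine setIntegral_mono_on (integrableOn_const (by simp)) ((auxJ1_int b τ hτ0).mono_set hsub)
      measurableSet_Ioc fun x hx => ?_
    have hx1 : 1 ≤ x := by nlinarith [hx.1]
    have hx0 : 0 < x := by linarith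
    have hu : τ + 1 < √x := Real.lt_sqrt_of_sq_lt hx.1
    have hx2 : x ≤ (τ + 2) ^ 2 := by nlinarith [hx.2]
    have hu2 : √x ≤ τ + 2 := (Real.sqrt_le_left (by linarith)).2 hx2
    have hE : (τ + 2)⁻¹ * Real.exp (-(τ + 2) ^ 2 / 2) ≤ auxE (b - 1) x := by
      unfold auxE
      have e1 : (τ + 2)⁻¹ ≤ x ^ (b - 1) := by
        calc (τ + 2)⁻¹ ≤ (√x)⁻¹ := by gcongr
          _ = x ^ (-(1/2) : ℝ) := by rw [Real.rpow_neg hx0.le, Real.sqrt_eq_rpow]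
          _ ≤ x ^ (b - 1) := Real.rpow_le_rpow_of_exponent_le hx1 (by linarith)
      have e2 : Real.exp (-(τ + 2) ^ 2 / 2) ≤ Real.exp (-x / 2) := by
        apply Real.exp_le_exp.2; linarith
      gcongr
    have := auxE_pos (b - 1) x hx0
    nlinarith
  refine le_trans (le_of_eq ?_) h2
  simp

lemma auxJ1_log (b : ℝ) (hb : 1/2 ≤ b) :
    ∃ K : ℝ, 0 < K ∧ ∀ τ : ℝ, 4 * b + 2 ≤ τ →
      0 < auxJ1 b τ ∧ |Real.log (auxJ1 b τ) + τ ^ 2 / 2| ≤ K * τ := by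
  refine ⟨2 * b + 10, by linarith, fun τ hτ => ?_⟩
  have hτ0 : 0 < τ := by linarith
  have ha : 0 < τ ^ 2 := by positivity
  have hl := auxJ1_lower b τ hb (by linarith)
  have hu := auxJ1_upper b τ hb (by linarith)
  have hpos : 0 < auxJ1 b τ := lt_of_lt_of_le (by positivity) hl
  refine ⟨hpos, ?_⟩
  have hl' := Real.log_le_log (by positivity) hl
  rw [Real.log_mul (by positivity) (Real.exp_pos _).ne', Real.log_exp, Real.log_inv] at hl'
  have hu' := Real.log_le_log hpos hu
  have hr : 0 < (τ ^ 2) ^ (b - 1/2) := Real.rpow_pos_of_pos ha _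
  unfold auxE at hu'
  rw [Real.log_mul (by norm_num) (by positivity), Real.log_mul hr.ne' (Real.exp_pos _).ne',
    Real.log_exp, Real.log_rpow ha, Real.log_pow] at hu'
  have l1 := Real.log_le_sub_one_of_pos hτ0
  have l2 := Real.log_le_sub_one_of_pos (show 0 < τ + 2 by linarith)
  have l3 := Real.log_le_sub_one_of_pos (show (0:ℝ) < 4 by norm_num)
  push_cast at hu'
  have l4 : (b - 1/2) * (2 * Real.log τ) ≤ (b - 1/2) * (2 * τ) :=
    mul_le_mul_of_nonneg_left (by linarith) (by linarith)
  rw [abs_le]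
  constructor
  · nlinarith
  · nlinarith

lemma aux_main (B : ℕ) (hB : 1 ≤ B) :
    ∃ K : ℝ, 0 < K ∧ ∀ᶠ τ : ℝ in atTop, ∃ I1 I2 : ℝ,
      (∫ x in Ioi (τ ^ 2), (τ - Real.sqrt x) * chiSqDensity B x) = -I1 ∧
      (∫ x in Ioi (τ ^ 2), (Real.sqrt x - τ) ^ 2 * chiSqDensity B x) = I2 ∧
      0 < I1 ∧ I1 ≤ 1 ∧ 0 ≤ I2 ∧ I2 ≤ I1 ∧ |Real.log I1 + τ ^ 2 / 2| ≤ K * τ := by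
  have hB' : (1:ℝ) ≤ B := by exact_mod_cast hB
  set b : ℝ := (B:ℝ) / 2 with hbdef
  have hb : 1/2 ≤ b := by rw [hbdef]; linarith
  obtain ⟨K, hK, h⟩ := auxJ1_log b hb
  set Z : ℝ := (2:ℝ) ^ b * Real.Gamma b with hZ
  have hZ0 : 0 < Z := mul_pos (Real.rpow_pos_of_pos (by norm_num) _)
    (Real.Gamma_pos_of_pos (by linarith))
  refine ⟨K + |Real.log Z|, by positivity, ?_⟩
  filter_upwards [eventually_ge_atTop (4 * b + 2),
    eventually_ge_atTop (2 * (K + |Real.log Z|))] with τ h1 h2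
  obtain ⟨hp, hlog⟩ := h τ h1
  have hτ0 : 1 ≤ τ := by linarith
  have hL : |Real.log (auxJ1 b τ / Z) + τ ^ 2 / 2| ≤ (K + |Real.log Z|) * τ := by
    rw [Real.log_div hp.ne' hZ0.ne']
    have : |Real.log Z| ≤ |Real.log Z| * τ := le_mul_of_one_le_right (abs_nonneg _) hτ0
    have h3 := abs_sub (Real.log (auxJ1 b τ) + τ ^ 2 / 2) (Real.log Z)
    calc _ = |Real.log (auxJ1 b τ) + τ ^ 2 / 2 - Real.log Z| := by congr 1; ring
      _ ≤ _ := h3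
      _ ≤ _ := by linarith
  refine ⟨auxJ1 b τ / Z, auxJ2 b τ / Z, ?_, ?_, by positivity, ?_,
    div_nonneg (auxJ2_nonneg b τ) hZ0.le, ?_, hL⟩
  · unfold auxJ1
    rw [← integral_div, ← integral_neg]
    congr 1; ext x
    unfold chiSqDensity auxE
    ring
  · unfold auxJ2
    rw [← integral_div]
    congr 1; ext x
    unfold chiSqDensity auxE
    ring
  · have := (abs_le.1 hL).2
    have h5 : Real.log (auxJ1 b τ / Z) ≤ 0 := by nlinarith
    exact (Real.log_nonpos_iff (by positivity)).1 h5
  · gcongr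
    exact auxJ2_le b τ hb (by linarith)

/-- The group LASSO phase transition satisfies `ρ^L(δ) ∼ B / (2 log(1/δ))` as `δ → 0`:
along the parametrization by the optimal threshold `τ`,
`R(τ) · 2 log(1/D(τ)) / B → 1` as `τ → ∞`. -/
theorem stmt11 (B : ℕ) (hB : 1 ≤ B) :
    Tendsto
      (fun τ : ℝ => groupLassoRho B τ * (2 * Real.log (1 / groupLassoDelta B τ)) / B)
      atTop (nhds 1) := by
  have hB' : (1:ℝ) ≤ B := by exact_mod_cast hB
  obtain ⟨K, hK, hmain⟩ := aux_main B hB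
  set I2 : ℝ → ℝ := fun τ => ∫ x in Ioi (τ ^ 2), (Real.sqrt x - τ) ^ 2 * chiSqDensity B x with hI2
  set D := groupLassoDelta B with hD
  have hinv : Tendsto (fun τ : ℝ => τ⁻¹) atTop (nhds 0) := tendsto_inv_atTop_zero
  -- collected facts
  have facts : ∀ᶠ τ : ℝ in atTop, 0 < D τ ∧ 0 ≤ I2 τ ∧ I2 τ ≤ 1 ∧ I2 τ / (B * D τ) ≤ 2 * τ⁻¹ ∧
      |-Real.log (D τ) - τ ^ 2 / 2| ≤ (K + 3 + 2 * B) * τ := by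
    filter_upwards [hmain, eventually_ge_atTop 1] with τ ⟨J1, J2, e1, e2, hJ1, hJ1', hJ2, hJ21, hl⟩ hτ
    have hDτ : D τ = ((B + τ ^ 2) * J1 + τ * J2) / (B * τ + B * J1) := by
      simp only [hD, groupLassoDelta, e1, e2]
      congr 1 <;> ring
    have hI : I2 τ = J2 := e2
    rw [hI]
    have hDpos : 0 < D τ := by rw [hDτ]; positivity
    have hden : 0 < B * τ + B * J1 := by positivity
    have hlow : J1 * (2 * B : ℝ)⁻¹ * τ ≤ D τ := by
      rw [hDτ, le_div_iff₀ hden]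
      have : J1 * (2 * B : ℝ)⁻¹ * τ * (B * τ + B * J1) = J1 * τ * (τ + J1) / 2 := by
        field_simp
      rw [this]
      have : 0 ≤ J1 * (τ * (τ - J1)) := by
        have : 0 ≤ τ - J1 := by linarith
        positivity
      nlinarith [mul_nonneg (by linarith : 0 ≤ τ) hJ2, mul_pos hJ1 (by linarith : (0:ℝ) < B)]
    have hup : D τ ≤ 3 * τ * J1 := by
      rw [hDτ, div_le_iff₀ hden]
      have a1 : (B:ℝ) * J1 ≤ B * J1 * τ ^ 2 := le_mul_of_one_le_right (by positivity) (by nlinarith)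
      have a2 : τ * J2 ≤ τ * J1 := by gcongr
      have a3 : τ * J1 ≤ τ * J1 * (B * τ) := le_mul_of_one_le_right (by positivity) (by nlinarith)
      have a4 : τ ^ 2 * J1 ≤ τ ^ 2 * J1 * B := le_mul_of_one_le_right (by positivity) hB'
      have a5 : 0 ≤ 3 * τ * J1 * (B * J1) := by positivity
      nlinarith
    refine ⟨hDpos, hJ2, hJ21.trans hJ1', ?_, ?_⟩
    · rw [div_le_iff₀ (by positivity)]
      have : 2 * τ⁻¹ * (B * (J1 * (2 * B : ℝ)⁻¹ * τ)) = J1 := by field_simp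
      calc J2 ≤ J1 := hJ21
        _ = _ := this.symm
        _ ≤ _ := by gcongr
    · have m1 := Real.log_le_log (by positivity) hlow
      have m2 := Real.log_le_log hDpos hup
      rw [Real.log_mul (by positivity) (by positivity), Real.log_mul (by positivity) (by positivity),
        Real.log_inv] at m1
      rw [Real.log_mul (by positivity) (by positivity),
        Real.log_mul (by positivity) (by positivity)] at m2
      have l1 := Real.log_le_sub_one_of_pos (show 0 < τ by linarith)
      have l2 := Real.log_le_sub_one_of_pos (show 0 < 2 * (B:ℝ) by positivity)
      have l3 := Real.log_le_sub_one_of_pos (show (0:ℝ) < 3 by norm_num)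
      have l4 := Real.log_nonneg hτ
      have := abs_le.1 hl
      have l5 : (B:ℝ) ≤ B * τ := le_mul_of_one_le_right (by positivity) hτ
      rw [abs_le]
      constructor <;> nlinarith
  have hDI : Tendsto (fun τ => I2 τ / (B * D τ)) atTop (nhds 0) := by
    refine squeeze_zero' ?_ ?_ (by simpa using hinv.const_mul 2)
    · filter_upwards [facts] with τ h
      have := h.1; have := h.2.1; positivity
    · filter_upwards [facts] with τ h using h.2.2.2.1
  have hinv2 : Tendsto (fun τ : ℝ => (τ⁻¹) ^ 2) atTop (nhds 0) := by simpa using hinv.pow 2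
  have hI2t : Tendsto (fun τ => I2 τ * (τ⁻¹) ^ 2) atTop (nhds 0) := by
    refine squeeze_zero' ?_ ?_ hinv2
    · filter_upwards [facts] with τ h
      have := h.2.1; positivity
    · filter_upwards [facts] with τ h
      exact mul_le_of_le_one_left (by positivity) h.2.2.1
  have hL : Tendsto (fun τ => 2 * (-Real.log (D τ)) * (τ⁻¹) ^ 2) atTop (nhds 1) := by
    have : Tendsto (fun τ => 2 * (-Real.log (D τ)) * (τ⁻¹) ^ 2 - 1) atTop (nhds 0) := by
      refine squeeze_zero_norm' (a := fun τ => 2 * (K + 3 + 2 * B) * τ⁻¹) ?_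
        (by simpa using hinv.const_mul (2 * (K + 3 + 2 * B)))
      filter_upwards [facts, eventually_ge_atTop 1] with τ h hτ
      have h5 := h.2.2.2.2
      have : 2 * (-Real.log (D τ)) * (τ⁻¹) ^ 2 - 1 =
          (-Real.log (D τ) - τ ^ 2 / 2) * (2 * (τ⁻¹) ^ 2) := by field_simp
      rw [this, Real.norm_eq_abs, abs_mul, abs_of_nonneg (show 0 ≤ 2 * (τ⁻¹) ^ 2 by positivity)]
      calc _ ≤ (K + 3 + 2 * B) * τ * (2 * (τ⁻¹) ^ 2) := by gcongr
        _ = _ := by field_simp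
    simpa using this.add_const 1
  have hA : Tendsto (fun τ => (1 - I2 τ / (B * D τ)) /
      (B * (τ⁻¹) ^ 2 + 1 - I2 τ * (τ⁻¹) ^ 2)) atTop (nhds 1) := by
    have := (hDI.const_sub 1).div (((hinv2.const_mul (B:ℝ)).add_const 1).sub hI2t) (by simp)
    rw [mul_zero, zero_add, sub_zero, div_one] at this
    exact this
  have hfin := hA.mul hL
  rw [one_mul] at hfin
  refine hfin.congr' ?_
  filter_upwards [facts, eventually_ge_atTop 1] with τ h hτ
  have hDp := h.1
  have hI1 := h.2.2.1
  have e : groupLassoRho B τ = (B * D τ - I2 τ) / (D τ * (B + τ ^ 2 - I2 τ)) := rfl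
  have hq : 0 < B + τ ^ 2 - I2 τ := by nlinarith
  have e2 : B * (τ⁻¹) ^ 2 + 1 - I2 τ * (τ⁻¹) ^ 2 = (B + τ ^ 2 - I2 τ) * (τ⁻¹) ^ 2 := by
    field_simp
  rw [e, e2, one_div, Real.log_inv]
  field_simp
end

section
/- Fix an integer B ≥ 1 and a constant γ ∈ (0,1). For ε ∈ (0, 1/2) set μ(ε) = √(2(1 − γ) log((1 − ε)/ε)). Let X be a random vector in ℝ^B with law (1 − ε)δ₀ + ε G*_{μ(ε)}, where G*_{μ(ε)} is the uniform probability measure on the sphere of radius μ(ε) centered at the origin of ℝ^B; let Z be an independent standard Gaussian random vector in ℝ^B (coordinates i.i.d. N(0,1)); and set Y = X + Z. Define the Bayes risk M_B(ε) = (1/B) E[ ‖X − E[X | Y]‖₂² ]. Then lim_{ε→0⁺} M_B(ε) · B / (ε μ(ε)²) = 1; equivalently, M_B(ε) ∼ ε (2(1 − γ)/B) log((1 − ε)/ε) as ε → 0. -/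
open MeasureTheory ProbabilityTheory Real Metric Filter

/-- The uniform (normalized Haar, i.e. rotation-invariant) probability measure on the unit
sphere of `ℝ^B`, obtained by normalizing the surface measure `volume.toSphere`. -/
noncomputable def sphereUniform (B : ℕ) :
    Measure (sphere (0 : EuclideanSpace ℝ (Fin B)) 1) :=
  ((volume : Measure (EuclideanSpace ℝ (Fin B))).toSphere Set.univ)⁻¹ •
    (volume : Measure (EuclideanSpace ℝ (Fin B))).toSphere

/-- The law of a standard Gaussian random vector in `ℝ^B` (coordinates i.i.d. `N(0,1)`). -/
noncomputable def stdGaussianE (B : ℕ) : Measure (EuclideanSpace ℝ (Fin B)) :=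
  (Measure.pi fun _ : Fin B => gaussianReal 0 1).map (EuclideanSpace.equiv (Fin B) ℝ).symm

/-- `μ(ε) = √(2(1 − γ) log((1 − ε)/ε))`. -/
noncomputable def muEps (γ ε : ℝ) : ℝ :=
  Real.sqrt (2 * (1 - γ) * Real.log ((1 - ε) / ε))

/-- The mixture signal law `(1 − ε)δ₀ + ε G*_{μ(ε)}`, with `G*_{μ(ε)}` uniform on the sphere
of radius `μ(ε)` centered at the origin of `ℝ^B`. -/
noncomputable def signalLaw (B : ℕ) (γ ε : ℝ) : Measure (EuclideanSpace ℝ (Fin B)) :=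
  ENNReal.ofReal (1 - ε) • Measure.dirac 0 +
    ENNReal.ofReal ε •
      (sphereUniform B).map
        (fun θ : sphere (0 : EuclideanSpace ℝ (Fin B)) 1 =>
          muEps γ ε • (θ : EuclideanSpace ℝ (Fin B)))

/-- The joint law of `(X, Z)` where `X ∼ (1 − ε)δ₀ + ε G*_{μ(ε)}` and `Z` is an independent
standard Gaussian vector in `ℝ^B`. -/
noncomputable def jointLaw (B : ℕ) (γ ε : ℝ) :
    Measure (EuclideanSpace ℝ (Fin B) × EuclideanSpace ℝ (Fin B)) :=
  (signalLaw B γ ε).prod (stdGaussianE B)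

/-- The Bayes risk `M_B(ε) = (1/B) E[‖X − E[X | Y]‖₂²]` where `Y = X + Z`; the conditional
expectation is taken with respect to the σ-algebra generated by `Y`. -/
noncomputable def bayesRisk (B : ℕ) (γ ε : ℝ) : ℝ :=
  (1 / (B : ℝ)) *
    ∫ ω, ‖ω.1 -
        ((jointLaw B γ ε)[(fun ω' : EuclideanSpace ℝ (Fin B) × EuclideanSpace ℝ (Fin B) =>
            ω'.1) |
          MeasurableSpace.comap
            (fun ω' : EuclideanSpace ℝ (Fin B) × EuclideanSpace ℝ (Fin B) => ω'.1 + ω'.2)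
            inferInstance]) ω‖ ^ 2
      ∂(jointLaw B γ ε)

lemma gauss_shift_one (a : ℝ) :
    gaussianReal a 1 = (gaussianReal 0 1).withDensity
      (fun x => ENNReal.ofReal (Real.exp (a * x - a ^ 2 / 2))) := by
  rw [gaussianReal_of_var_ne_zero _ one_ne_zero, gaussianReal_of_var_ne_zero _ one_ne_zero,
    ← withDensity_mul _ (measurable_gaussianPDF _ _) (by fun_prop)]
  congr 1
  ext x
  simp only [gaussianPDF, Pi.mul_apply]
  rw [← ENNReal.ofReal_mul (gaussianPDFReal_nonneg _ _ _)]
  congr 1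
  simp only [gaussianPDFReal]
  rw [mul_assoc _ (Real.exp _) (Real.exp _), ← Real.exp_add]
  congr 2
  simp only [NNReal.coe_one]
  ring

lemma gauss_shift {B : ℕ} (a : Fin B → ℝ) :
    (Measure.pi fun _ : Fin B => gaussianReal 0 1).map (fun x i => a i + x i) =
      (Measure.pi fun _ : Fin B => gaussianReal 0 1).withDensity
        (fun x => ∏ i, ENNReal.ofReal (Real.exp (a i * x i - a i ^ 2 / 2))) := by
  rw [Measure.pi_map_pi (f := fun i x => a i + x) (fun i => by fun_prop)]
  have : ∀ i, (gaussianReal 0 1).map (fun x => a i + x) = gaussianReal (a i) 1 := by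
    intro i
    rw [gaussianReal_map_const_add]; simp
  simp only [this]
  refine Measure.pi_eq fun s hs => ?_
  rw [withDensity_apply _ (MeasurableSet.univ_pi hs), ← lintegral_indicator (MeasurableSet.univ_pi hs)]
  have h1 : ∀ x : Fin B → ℝ, (Set.univ.pi s).indicator
      (fun x => ∏ i, ENNReal.ofReal (Real.exp (a i * x i - a i ^ 2 / 2))) x =
      ∏ i, (s i).indicator (fun y => ENNReal.ofReal (Real.exp (a i * y - a i ^ 2 / 2))) (x i) := by
    intro x
    by_cases hx : x ∈ Set.univ.pi s
    · rw [Set.indicator_of_mem hx]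
      refine Finset.prod_congr rfl fun i _ => ?_
      rw [Set.indicator_of_mem (hx i (Set.mem_univ i))]
    · rw [Set.indicator_of_notMem hx]
      simp only [Set.mem_pi, Set.mem_univ, true_imp_iff, not_forall] at hx
      obtain ⟨i, hi⟩ := hx
      exact (Finset.prod_eq_zero (Finset.mem_univ i) (Set.indicator_of_notMem hi _)).symm
  have hm : ∀ i, Measurable ((s i).indicator
      (fun y => ENNReal.ofReal (Real.exp (a i * y - a i ^ 2 / 2)))) :=
    fun i => Measurable.indicator (by fun_prop) (hs i)
  simp only [h1]
  rw [lintegral_prod_eq_prod_lintegral_of_indepFun Finset.univ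
    (fun i (x : Fin B → ℝ) => (s i).indicator
      (fun y => ENNReal.ofReal (Real.exp (a i * y - a i ^ 2 / 2))) (x i))
    (iIndepFun_pi (fun i => (hm i).aemeasurable)) (fun i => (hm i).comp (measurable_pi_apply i))]
  refine Finset.prod_congr rfl fun i _ => ?_
  rw [(measurePreserving_eval (fun _ : Fin B => gaussianReal 0 1) i).lintegral_comp (hm i),
    lintegral_indicator (hs i), gauss_shift_one (a i), withDensity_apply _ (hs i)]

instance stdGaussianE_prob (B : ℕ) : IsProbabilityMeasure (stdGaussianE B) := by
  unfold stdGaussianE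
  exact Measure.isProbabilityMeasure_map (by fun_prop)

lemma sphereUniform_prob (B : ℕ) (hB : 1 ≤ B) : IsProbabilityMeasure (sphereUniform B) := by
  have : Nonempty (Fin B) := ⟨⟨0, hB⟩⟩
  constructor
  unfold sphereUniform
  rw [Measure.smul_apply, smul_eq_mul]
  refine ENNReal.inv_mul_cancel ?_ (measure_ne_top _ _)
  rw [Ne, Measure.measure_univ_eq_zero]
  exact Measure.toSphere_ne_zero _

lemma stdGaussianE_shift {B : ℕ} (a : EuclideanSpace ℝ (Fin B)) (f : EuclideanSpace ℝ (Fin B) → ENNReal)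
    (hf : Measurable f) :
    ∫⁻ z, f (a + z) ∂(stdGaussianE B) =
      ∫⁻ z, ENNReal.ofReal (Real.exp (inner ℝ a z - ‖a‖ ^ 2 / 2)) * f z ∂(stdGaussianE B) := by
  have hE : Measurable (EuclideanSpace.equiv (Fin B) ℝ).symm := by fun_prop
  unfold stdGaussianE
  rw [lintegral_map (by fun_prop) hE, lintegral_map (by fun_prop) hE]
  have h := congrArg (fun ν => ∫⁻ x, f ((EuclideanSpace.equiv (Fin B) ℝ).symm x) ∂ν)
    (gauss_shift (fun i => a i))
  rw [lintegral_map (by fun_prop) (by fun_prop),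
    lintegral_withDensity_eq_lintegral_mul _ (by fun_prop) (by fun_prop)] at h
  refine Eq.trans (lintegral_congr fun x => ?_) (h.trans (lintegral_congr fun x => ?_))
  · congr 1
  symm
  rw [Pi.mul_apply]
  congr 1
  rw [← ENNReal.ofReal_prod_of_nonneg (fun i _ => (Real.exp_pos _).le), ← Real.exp_sum]
  congr 2
  rw [EuclideanSpace.real_norm_sq_eq, Finset.sum_sub_distrib, Finset.sum_div]
  congr 1
  simp [PiLp.inner_apply, mul_comm]

lemma shift_bound {B : ℕ} (a : EuclideanSpace ℝ (Fin B)) (K : ℝ)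
    (f : EuclideanSpace ℝ (Fin B) → ENNReal) (hf : Measurable f) :
    ∫⁻ z in closedBall 0 K, f (a + z) ∂(stdGaussianE B) ≤
      ENNReal.ofReal (Real.exp (‖a‖ * K + ‖a‖ ^ 2 / 2)) * ∫⁻ z, f z ∂(stdGaussianE B) := by
  have hm : Measurable ((closedBall a K).indicator f) := hf.indicator measurableSet_closedBall
  have h := stdGaussianE_shift a _ hm
  rw [← lintegral_indicator measurableSet_closedBall]
  calc _ = ∫⁻ z, (closedBall a K).indicator f (a + z) ∂(stdGaussianE B) := by
        refine lintegral_congr fun z => ?_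
        simp [Set.indicator, mem_closedBall, dist_eq_norm]
    _ = _ := h
    _ ≤ ∫⁻ z, ENNReal.ofReal (Real.exp (‖a‖ * K + ‖a‖ ^ 2 / 2)) * f z ∂(stdGaussianE B) := by
        refine lintegral_mono fun z => ?_
        by_cases hz : z ∈ closedBall a K
        · rw [Set.indicator_of_mem hz]
          gcongr
          have h1 : inner ℝ a z = inner ℝ a (z - a) + ‖a‖ ^ 2 := by
            rw [inner_sub_right, real_inner_self_eq_norm_sq]; ring
          have h2 := real_inner_le_norm a (z - a)
          have h3 : ‖z - a‖ ≤ K := by simpa [dist_eq_norm] using hz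
          have h4 := mul_le_mul_of_nonneg_left h3 (norm_nonneg a)
          linarith
        · simp [Set.indicator_of_notMem hz]
    _ = _ := lintegral_const_mul _ hf

lemma quad_bound {E : Type*} [NormedAddCommGroup E] [InnerProductSpace ℝ E] (a h : E) (r : ℝ)
    (hr : 0 < r) : ‖a‖ ^ 2 / (1 + r) ≤ ‖a - h‖ ^ 2 + r⁻¹ * ‖h‖ ^ 2 := by
  have h1 : ‖a‖ ≤ ‖a - h‖ + ‖h‖ := by simpa using norm_add_le (a - h) h
  have h2 : ‖a‖ ^ 2 ≤ (‖a - h‖ + ‖h‖) ^ 2 := by gcongr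
  rw [div_le_iff₀ (by positivity)]
  refine h2.trans ?_
  have : (‖a - h‖ ^ 2 + r⁻¹ * ‖h‖ ^ 2) * (1 + r) - (‖a - h‖ + ‖h‖) ^ 2
      = (r * ‖a - h‖ - ‖h‖) ^ 2 / r := by field_simp; ring
  have : 0 ≤ (r * ‖a - h‖ - ‖h‖) ^ 2 / r := by positivity
  linarith

lemma point_bound {B : ℕ} (a : EuclideanSpace ℝ (Fin B)) (K r ε : ℝ) (hr : 0 < r) (hε : 0 ≤ ε)
    (hre : ε * r⁻¹ * Real.exp (‖a‖ * K + ‖a‖ ^ 2 / 2) ≤ 1 - ε)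
    (h : EuclideanSpace ℝ (Fin B) → EuclideanSpace ℝ (Fin B)) (hh : Measurable h) :
    ENNReal.ofReal (ε * (‖a‖ ^ 2 / (1 + r))) * stdGaussianE B (closedBall 0 K) ≤
      ENNReal.ofReal (1 - ε) * ∫⁻ z, ENNReal.ofReal (‖h z‖ ^ 2) ∂(stdGaussianE B) +
      ENNReal.ofReal ε * ∫⁻ z, ENNReal.ofReal (‖a - h (a + z)‖ ^ 2) ∂(stdGaussianE B) := by
  have h1 := shift_bound a K (fun z => ENNReal.ofReal (‖h z‖ ^ 2)) (by fun_prop)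
  calc _ = ENNReal.ofReal ε * ∫⁻ z in closedBall 0 K, ENNReal.ofReal (‖a‖ ^ 2 / (1 + r))
          ∂(stdGaussianE B) := by
        rw [setLIntegral_const, ENNReal.ofReal_mul hε, mul_assoc]
    _ ≤ ENNReal.ofReal ε * ∫⁻ z in closedBall 0 K, (ENNReal.ofReal (‖a - h (a + z)‖ ^ 2) +
          ENNReal.ofReal r⁻¹ * ENNReal.ofReal (‖h (a + z)‖ ^ 2)) ∂(stdGaussianE B) := by
        gcongr with z
        rw [← ENNReal.ofReal_mul (by positivity), ← ENNReal.ofReal_add (by positivity) (by positivity)]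
        exact ENNReal.ofReal_le_ofReal (quad_bound _ _ _ hr)
    _ = ENNReal.ofReal ε * (ENNReal.ofReal r⁻¹ * ∫⁻ z in closedBall 0 K,
            ENNReal.ofReal (‖h (a + z)‖ ^ 2) ∂(stdGaussianE B)) +
          ENNReal.ofReal ε * ∫⁻ z in closedBall 0 K, ENNReal.ofReal (‖a - h (a + z)‖ ^ 2)
            ∂(stdGaussianE B) := by
        rw [lintegral_add_left (by fun_prop), lintegral_const_mul _ (by fun_prop), mul_add, add_comm]
    _ ≤ ENNReal.ofReal ε * (ENNReal.ofReal r⁻¹ *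
          (ENNReal.ofReal (Real.exp (‖a‖ * K + ‖a‖ ^ 2 / 2)) *
            ∫⁻ z, ENNReal.ofReal (‖h z‖ ^ 2) ∂(stdGaussianE B))) +
          ENNReal.ofReal ε * ∫⁻ z, ENNReal.ofReal (‖a - h (a + z)‖ ^ 2)
            ∂(stdGaussianE B) := by
        gcongr
        exact Measure.restrict_le_self
    _ ≤ _ := by
        refine add_le_add ?_ le_rfl
        rw [← mul_assoc, ← mul_assoc, ← ENNReal.ofReal_mul hε, ← ENNReal.ofReal_mul (by positivity)]
        gcongr

lemma lintegral_joint {B : ℕ} (γ ε : ℝ)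
    (F : EuclideanSpace ℝ (Fin B) × EuclideanSpace ℝ (Fin B) → ENNReal) (hF : Measurable F) :
    ∫⁻ ω, F ω ∂(jointLaw B γ ε) =
      ENNReal.ofReal (1 - ε) * ∫⁻ z, F (0, z) ∂(stdGaussianE B) +
      ENNReal.ofReal ε * ∫⁻ θ, ∫⁻ z, F (muEps γ ε • (θ : EuclideanSpace ℝ (Fin B)), z)
        ∂(stdGaussianE B) ∂(sphereUniform B) := by
  unfold jointLaw signalLaw
  rw [lintegral_prod _ hF.aemeasurable, lintegral_add_measure, lintegral_smul_measure,
    lintegral_smul_measure, lintegral_dirac' _ hF.lintegral_prod_right',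
    lintegral_map hF.lintegral_prod_right' (by fun_prop)]
  simp

lemma jointLaw_prob (B : ℕ) (hB : 1 ≤ B) (γ ε : ℝ) (h0 : 0 < ε) (h1 : ε < 1) :
    IsProbabilityMeasure (jointLaw B γ ε) := by
  have := sphereUniform_prob B hB
  constructor
  rw [← lintegral_one, lintegral_joint _ _ _ (by fun_prop)]
  simp only [lintegral_one, measure_univ, mul_one]
  rw [← ENNReal.ofReal_add (by linarith) h0.le]
  simp

lemma lintegral_fst {B : ℕ} (hB : 1 ≤ B) (γ ε : ℝ) (h0 : 0 < ε) :
    ∫⁻ ω, ENNReal.ofReal (‖ω.1‖ ^ 2) ∂(jointLaw B γ ε) =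
      ENNReal.ofReal (ε * muEps γ ε ^ 2) := by
  have := sphereUniform_prob B hB
  rw [lintegral_joint _ _ _ (by fun_prop)]
  simp [norm_smul, ENNReal.ofReal_mul h0.le]

lemma lower_bound {B : ℕ} (hB : 1 ≤ B) (γ ε K r : ℝ) (h0 : 0 < ε) (hr : 0 < r)
    (hre : ε * r⁻¹ * Real.exp (muEps γ ε * K + muEps γ ε ^ 2 / 2) ≤ 1 - ε)
    (h : EuclideanSpace ℝ (Fin B) → EuclideanSpace ℝ (Fin B)) (hh : Measurable h) :
    ENNReal.ofReal (ε * (muEps γ ε ^ 2 / (1 + r))) * stdGaussianE B (closedBall 0 K) ≤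
      ∫⁻ ω, ENNReal.ofReal (‖ω.1 - h (ω.1 + ω.2)‖ ^ 2) ∂(jointLaw B γ ε) := by
  have := sphereUniform_prob B hB
  have hmu : 0 ≤ muEps γ ε := Real.sqrt_nonneg _
  rw [lintegral_joint _ _ _ (by fun_prop)]
  calc _ = ∫⁻ θ, ENNReal.ofReal (ε * (muEps γ ε ^ 2 / (1 + r))) * stdGaussianE B (closedBall 0 K)
          ∂(sphereUniform B) := by simp
    _ ≤ ∫⁻ θ, (ENNReal.ofReal (1 - ε) * ∫⁻ z, ENNReal.ofReal (‖h z‖ ^ 2) ∂(stdGaussianE B) +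
          ENNReal.ofReal ε * ∫⁻ z, ENNReal.ofReal (‖muEps γ ε • (θ : EuclideanSpace ℝ (Fin B)) -
            h (muEps γ ε • (θ : EuclideanSpace ℝ (Fin B)) + z)‖ ^ 2) ∂(stdGaussianE B))
          ∂(sphereUniform B) := by
        refine lintegral_mono fun θ => ?_
        have hn : ‖muEps γ ε • (θ : EuclideanSpace ℝ (Fin B))‖ = muEps γ ε := by
          simp [norm_smul, abs_of_nonneg hmu]
        have := point_bound (muEps γ ε • (θ : EuclideanSpace ℝ (Fin B))) K r ε hr h0.le
          (by rw [hn]; exact hre) h hh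
        rwa [hn] at this
    _ = _ := by
        rw [lintegral_add_left (by fun_prop), lintegral_const_mul' (ENNReal.ofReal ε) _ ENNReal.ofReal_ne_top]
        simp

lemma condExp_sub_le {Ω E : Type*} {m m0 : MeasurableSpace Ω} (hm : m ≤ m0) (P : Measure Ω)
    [IsProbabilityMeasure P] [NormedAddCommGroup E] [InnerProductSpace ℝ E] [CompleteSpace E]
    (X : Ω → E) (hX : MemLp X 2 P) :
    MemLp (fun ω => X ω - (P[X|m]) ω) 2 P ∧
    ∫⁻ ω, ENNReal.ofReal (‖X ω - (P[X|m]) ω‖ ^ 2) ∂P ≤ ∫⁻ ω, ENNReal.ofReal (‖X ω‖ ^ 2) ∂P := by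
  have : Fact (m ≤ m0) := ⟨hm⟩
  set f := hX.toLp X with hf
  set g : Lp E 2 P := (condExpL2 E ℝ hm f : Lp E 2 P) with hg
  have h1 : (g : Ω → E) =ᵐ[P] P[X|m] := hX.condExpL2_ae_eq_condExp (𝕜 := ℝ) hm
  have h2 : (fun ω => X ω - (P[X|m]) ω) =ᵐ[P] ((f - g : Lp E 2 P) : Ω → E) := by
    filter_upwards [h1, hX.coeFn_toLp, Lp.coeFn_sub f g] with ω a b c
    rw [c, Pi.sub_apply, a, b]
  have h3 : ‖f - g‖ ≤ ‖f‖ := by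
    have key : inner ℝ (f - g) g = 0 :=
      (lpMeas E ℝ m 2 P).starProjection_inner_eq_zero f _ (Submodule.coe_mem _)
    have h4 : ‖f‖ ^ 2 = ‖f - g‖ ^ 2 + ‖g‖ ^ 2 := by
      have := norm_add_sq_real (f - g) g
      rw [key] at this
      simpa using this
    have := sq_nonneg ‖g‖
    exact le_of_sq_le_sq (by linarith) (norm_nonneg _)
  have h5 : MemLp (fun ω => X ω - (P[X|m]) ω) 2 P := (Lp.memLp (f - g)).ae_eq h2.symm
  refine ⟨h5, ?_⟩
  have conv : ∀ Y : Ω → E, ∫⁻ ω, ENNReal.ofReal (‖Y ω‖ ^ 2) ∂P = eLpNorm Y 2 P ^ 2 := by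
    intro Y
    have := eLpNorm_nnreal_pow_eq_lintegral (f := Y) (μ := P) (p := 2) two_ne_zero
    simp only [NNReal.coe_ofNat, ENNReal.coe_ofNat, ENNReal.rpow_ofNat] at this
    rw [this]
    refine lintegral_congr fun ω => ?_
    rw [ENNReal.ofReal_pow (norm_nonneg _), ofReal_norm]
  rw [conv, conv]
  gcongr 1
  rw [eLpNorm_congr_ae h2, ← eLpNorm_congr_ae hX.coeFn_toLp]
  rw [Lp.norm_def, Lp.norm_def] at h3
  exact (ENNReal.toReal_le_toReal (Lp.eLpNorm_ne_top _) (Lp.eLpNorm_ne_top _)).1 h3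

lemma risk_bounds {B : ℕ} (hB : 1 ≤ B) (γ ε K r : ℝ) (h0 : 0 < ε) (h1 : ε < 1) (hr : 0 < r)
    (hre : ε * r⁻¹ * Real.exp (muEps γ ε * K + muEps γ ε ^ 2 / 2) ≤ 1 - ε) :
    ε * muEps γ ε ^ 2 * ((1 + r)⁻¹ * (stdGaussianE B).real (closedBall 0 K)) ≤ bayesRisk B γ ε * B ∧
    bayesRisk B γ ε * B ≤ ε * muEps γ ε ^ 2 := by
  have hP := jointLaw_prob B hB γ ε h0 h1
  have hB0 : (B : ℝ) ≠ 0 := by positivity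
  have hm : MeasurableSpace.comap
            (fun ω' : EuclideanSpace ℝ (Fin B) × EuclideanSpace ℝ (Fin B) => ω'.1 + ω'.2)
            inferInstance ≤ (inferInstance : MeasurableSpace
              (EuclideanSpace ℝ (Fin B) × EuclideanSpace ℝ (Fin B))) := by
    refine Measurable.comap_le ?_
    fun_prop
  have hX : MemLp (fun ω' : EuclideanSpace ℝ (Fin B) × EuclideanSpace ℝ (Fin B) => ω'.1) 2
      (jointLaw B γ ε) := by
    rw [memLp_two_iff_integrable_sq_norm (by fun_prop)]
    refine ⟨by fun_prop, ?_⟩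
    rw [hasFiniteIntegral_iff_ofReal (by filter_upwards with x; positivity), lintegral_fst hB γ ε h0]
    exact ENNReal.ofReal_lt_top
  obtain ⟨hL, hU⟩ := condExp_sub_le hm (jointLaw B γ ε) _ hX
  rw [lintegral_fst hB γ ε h0] at hU
  obtain ⟨h, hh, hc⟩ := (stronglyMeasurable_condExp (μ := jointLaw B γ ε)
    (f := fun ω' : EuclideanSpace ℝ (Fin B) × EuclideanSpace ℝ (Fin B) => ω'.1)
    (m := MeasurableSpace.comap
            (fun ω' : EuclideanSpace ℝ (Fin B) × EuclideanSpace ℝ (Fin B) => ω'.1 + ω'.2)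
            inferInstance)).exists_eq_measurable_comp
  have hlow := lower_bound hB γ ε K r h0 hr hre h hh.measurable
  have hR : bayesRisk B γ ε * B = (∫⁻ ω, ENNReal.ofReal (‖ω.1 -
        ((jointLaw B γ ε)[(fun ω' : EuclideanSpace ℝ (Fin B) × EuclideanSpace ℝ (Fin B) =>
            ω'.1) |
          MeasurableSpace.comap
            (fun ω' : EuclideanSpace ℝ (Fin B) × EuclideanSpace ℝ (Fin B) => ω'.1 + ω'.2)
            inferInstance]) ω‖ ^ 2) ∂(jointLaw B γ ε)).toReal := by
    unfold _root_.bayesRisk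
    rw [integral_eq_lintegral_of_nonneg_ae]
    · field_simp
    · filter_upwards with x
      exact sq_nonneg _
    · exact hL.1.norm.pow 2
  have hlow' : ENNReal.ofReal (ε * (muEps γ ε ^ 2 / (1 + r))) * stdGaussianE B (closedBall 0 K) ≤
      (∫⁻ ω, ENNReal.ofReal (‖ω.1 -
        ((jointLaw B γ ε)[(fun ω' : EuclideanSpace ℝ (Fin B) × EuclideanSpace ℝ (Fin B) =>
            ω'.1) |
          MeasurableSpace.comap
            (fun ω' : EuclideanSpace ℝ (Fin B) × EuclideanSpace ℝ (Fin B) => ω'.1 + ω'.2)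
            inferInstance]) ω‖ ^ 2) ∂(jointLaw B γ ε)) := by
    rw [hc]
    exact hlow
  rw [hR]
  constructor
  · have := ENNReal.toReal_mono (ne_top_of_le_ne_top ENNReal.ofReal_ne_top hU) hlow'
    rw [ENNReal.toReal_mul, ENNReal.toReal_ofReal (by positivity)] at this
    refine le_of_eq_of_le ?_ this
    rw [Measure.real]
    ring
  · have := ENNReal.toReal_mono ENNReal.ofReal_ne_top hU
    rwa [ENNReal.toReal_ofReal (by positivity)] at this

lemma ball_tendsto (B : ℕ) :
    Tendsto (fun K : ℝ => (stdGaussianE B).real (closedBall 0 K)) atTop (nhds 1) := by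
  have h := tendsto_measure_iUnion_atTop (μ := stdGaussianE B) (s := fun K : ℝ => closedBall 0 K)
    (fun a b hab => closedBall_subset_closedBall hab)
  have hu : (⋃ K : ℝ, closedBall (0 : EuclideanSpace ℝ (Fin B)) K) = Set.univ := by
    ext x
    simp only [Set.mem_iUnion, mem_closedBall, Set.mem_univ, iff_true]
    exact ⟨_, le_rfl⟩
  rw [hu, measure_univ] at h
  exact (ENNReal.tendsto_toReal ENNReal.one_ne_top).comp h

/-- Lemma 4.4 of the paper: the Bayes risk for the least favorable uniform-on-sphere signal
distribution satisfies `M_B(ε) ∼ ε μ(ε)²/B = ε (2(1 − γ)/B) log((1 − ε)/ε)` as `ε → 0⁺`. -/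
theorem stmt17 (B : ℕ) (hB : 1 ≤ B) (γ : ℝ) (hγ : γ ∈ Set.Ioo (0 : ℝ) 1) :
    Tendsto (fun ε : ℝ => bayesRisk B γ ε * B / (ε * muEps γ ε ^ 2))
      (nhdsWithin 0 (Set.Ioo (0 : ℝ) (1 / 2))) (nhds 1) := by

  obtain ⟨hγ0, hγ1⟩ := hγ
  have hpos : ∀ᶠ ε in nhdsWithin (0 : ℝ) (Set.Ioo (0 : ℝ) (1 / 2)), ε ∈ Set.Ioo (0 : ℝ) (1 / 2) :=
    self_mem_nhdsWithin
  have hlog : Tendsto (fun ε : ℝ => Real.log ((1 - ε) / ε))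
      (nhdsWithin 0 (Set.Ioo (0 : ℝ) (1 / 2))) atTop := by
    refine Real.tendsto_log_atTop.comp ?_
    have h1 : Tendsto (fun ε : ℝ => 1 - ε) (nhdsWithin 0 (Set.Ioo (0 : ℝ) (1 / 2))) (nhds 1) := by
      have : Tendsto (fun ε : ℝ => 1 - ε) (nhds 0) (nhds (1 - 0)) :=
        Continuous.tendsto (by fun_prop) 0
      simpa using this.mono_left nhdsWithin_le_nhds
    have h2 : Tendsto (fun ε : ℝ => ε⁻¹) (nhdsWithin 0 (Set.Ioo (0 : ℝ) (1 / 2))) atTop :=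
      tendsto_inv_nhdsGT_zero.mono_left (nhdsWithin_mono _ (fun x hx => hx.1))
    simpa [div_eq_mul_inv] using h1.pos_mul_atTop one_pos h2
  have hmu : Tendsto (fun ε : ℝ => muEps γ ε)
      (nhdsWithin 0 (Set.Ioo (0 : ℝ) (1 / 2))) atTop := by
    unfold muEps
    exact Real.tendsto_sqrt_atTop.comp (hlog.const_mul_atTop (by linarith))
  have hmupos := hmu.eventually_gt_atTop 0
  -- the likelihood-ratio constant
  have hr : Tendsto (fun ε : ℝ => Real.exp (-(γ / 4 * muEps γ ε ^ 2)))
      (nhdsWithin 0 (Set.Ioo (0 : ℝ) (1 / 2))) (nhds 0) := by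
    refine Real.tendsto_exp_neg_atTop_nhds_zero.comp ?_
    exact ((tendsto_pow_atTop two_ne_zero).comp hmu).const_mul_atTop (by linarith)
  have hG := (ball_tendsto B).comp (hmu.const_mul_atTop (r := γ / 4) (by linarith))
  have hlow : Tendsto (fun ε : ℝ => (1 + Real.exp (-(γ / 4 * muEps γ ε ^ 2)))⁻¹ *
      (stdGaussianE B).real (closedBall 0 (γ / 4 * muEps γ ε)))
      (nhdsWithin 0 (Set.Ioo (0 : ℝ) (1 / 2))) (nhds 1) := by
    have h := ((hr.const_add 1).inv₀ (by norm_num)).mul hG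
    simpa using h
  have hb : ∀ᶠ ε in nhdsWithin (0 : ℝ) (Set.Ioo (0 : ℝ) (1 / 2)),
      (1 + Real.exp (-(γ / 4 * muEps γ ε ^ 2)))⁻¹ *
        (stdGaussianE B).real (closedBall 0 (γ / 4 * muEps γ ε)) ≤
        bayesRisk B γ ε * B / (ε * muEps γ ε ^ 2) ∧
      bayesRisk B γ ε * B / (ε * muEps γ ε ^ 2) ≤ 1 := by
    filter_upwards [hpos, hmupos, hlog.eventually_gt_atTop 0] with ε hε hm hl
    obtain ⟨h0, h1⟩ := hε
    have hre : ε * (Real.exp (-(γ / 4 * muEps γ ε ^ 2)))⁻¹ *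
        Real.exp (muEps γ ε * (γ / 4 * muEps γ ε) + muEps γ ε ^ 2 / 2) ≤ 1 - ε := by
      have hsq : muEps γ ε ^ 2 = 2 * (1 - γ) * Real.log ((1 - ε) / ε) := by
        unfold muEps
        rw [Real.sq_sqrt]
        have : 0 < 1 - γ := by linarith
        positivity
      have hle : Real.exp (γ / 4 * muEps γ ε ^ 2) *
          Real.exp (muEps γ ε * (γ / 4 * muEps γ ε) + muEps γ ε ^ 2 / 2) ≤ (1 - ε) / ε := by
        rw [← Real.exp_add]
        calc _ ≤ Real.exp (Real.log ((1 - ε) / ε)) := by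
              refine Real.exp_le_exp.2 ?_
              have : γ / 4 * muEps γ ε ^ 2 + (muEps γ ε * (γ / 4 * muEps γ ε) + muEps γ ε ^ 2 / 2)
                = (1 + γ) / 2 * muEps γ ε ^ 2 := by ring
              rw [this, hsq]
              nlinarith [mul_nonneg (mul_nonneg hγ0.le hγ0.le) hl.le]
          _ = _ := Real.exp_log (div_pos (by linarith) h0)
      rw [Real.exp_neg, inv_inv, mul_assoc]
      rw [le_div_iff₀ h0] at hle
      linarith
    obtain ⟨hA, hB'⟩ := risk_bounds hB γ ε (γ / 4 * muEps γ ε) _ h0 (by linarith)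
      (Real.exp_pos (-(γ / 4 * muEps γ ε ^ 2))) hre
    have hd : 0 < ε * muEps γ ε ^ 2 := by positivity
    constructor
    · rw [le_div_iff₀ hd]; linarith
    · rw [div_le_iff₀ hd]; linarith
  exact tendsto_of_tendsto_of_tendsto_of_le_of_le' hlow tendsto_const_nhds
    (hb.mono fun _ h => h.1) (hb.mono fun _ h => h.2)
end
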